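/- arXiv:2402.07117 — 3 statements merged into one kernel-verified Lean document; each statement's English description precedes it below -/
import Mathlib

section
/- (Besicovitch's theorem.) Let p₁, …, p_s be distinct prime numbers and r₁, …, r_s positive integers none of which is divisible by any of p₁, …, p_s; set y_i = r_i · p_i for each i. Let n₁, …, n_s be positive integers and let x_i be the positive real n_i-th root of y_i, i.e., the unique positive real solution of x^{n_i} − y_i = 0. Then for every polynomial P in s variables with rational coefficients whose degree in the i-th variable is at most n_i − 1 for each i, if P(x₁, …, x_s) = 0 then every coefficient of P is zero. Equivalently, the real numbers ∏_{i=1}^{s} x_i^{k_i}, ranging over all multi-indices (k₁, …, k_s) with 0 ≤ k_i ≤ n_i − 1, are linearly independent over ℚ. -/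
open Polynomial IntermediateField in
/-- An irrational positive real number with a rational power has a minimal polynomial `X ^ e - b`
with `2 ≤ e`, so its subleading coefficient vanishes. -/
theorem minpoly_nextCoeff_eq_zero_of_pow_eq_ratCast {x : ℝ} (hx : 0 < x) {N : ℕ} (hN : N ≠ 0)
    {q : ℚ} (hq : x ^ N = (q : ℝ)) (hirr : Irrational x) : (minpoly ℚ x).nextCoeff = 0 := by
  have hint : IsIntegral ℚ x := by
    refine IsIntegral.of_pow (Nat.pos_of_ne_zero hN) ?_
    rw [hq]
    exact isIntegral_algebraMap (R := ℚ) (A := ℝ) (x := q)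
  set e := (minpoly ℚ x).natDegree with he
  have he0 : 0 < e := minpoly.natDegree_pos hint
  obtain ⟨b, hb⟩ : ∃ b : ℚ, x ^ e = (b : ℝ) := by
    refine ⟨|Algebra.norm ℚ (AdjoinSimple.gen ℚ x)|, ?_⟩
    have hgen : AdjoinSimple.gen ℚ x ^ N = algebraMap ℚ ℚ⟮x⟯ q := by
      apply Subtype.ext
      simpa using hq
    have hnorm := congrArg (Algebra.norm ℚ) hgen
    rw [map_pow, Algebra.norm_algebraMap, adjoin.finrank hint, ← he] at hnorm
    have hnorm' : ((|Algebra.norm ℚ (AdjoinSimple.gen ℚ x)| : ℚ) : ℝ) ^ N = (x ^ e) ^ N := by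
      rw [← pow_mul, mul_comm, pow_mul, hq, Rat.cast_abs, ← abs_pow, ← Rat.cast_pow, hnorm,
        Rat.cast_pow, ← hq, abs_of_pos (by positivity)]
    exact ((pow_left_inj₀ (by positivity) (by positivity) hN).1 hnorm').symm
  have hmin : X ^ e - C b = minpoly ℚ x := by
    refine (eq_of_monic_of_dvd_of_natDegree_le (minpoly.monic hint) (monic_X_pow_sub_C b he0.ne')
      (minpoly.dvd ℚ x (by simp [hb])) ?_)
    rw [natDegree_X_pow_sub_C]
  have he1 : e ≠ 1 := by
    intro h
    rw [h, pow_one] at hb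
    exact hirr ⟨b, hb.symm⟩
  rw [nextCoeff_of_natDegree_pos he0, ← he, ← hmin, coeff_sub, coeff_X_pow, coeff_C,
    if_neg (by omega), if_neg (by omega), sub_zero]

/-- Positive real numbers with rational powers and pairwise irrational ratios are linearly
independent over `ℚ`. -/
theorem linearIndependent_of_pow_eq_ratCast_of_irrational_div {ι : Type*} [Fintype ι] {a : ι → ℝ}
    (ha : ∀ i, 0 < a i) {N : ℕ} (hN : N ≠ 0) (hpow : ∀ i, ∃ q : ℚ, a i ^ N = (q : ℝ))
    (hirr : ∀ i j, i ≠ j → Irrational (a i / a j)) : LinearIndependent ℚ a := by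
  classical
  rw [Fintype.linearIndependent_iff]
  intro c hc j
  let K := IntermediateField.adjoin ℚ (Set.range a)
  have hfin : FiniteDimensional ℚ K := by
    apply IntermediateField.finiteDimensional_adjoin
    rintro _ ⟨i, rfl⟩
    obtain ⟨q, hq⟩ := hpow i
    refine IsIntegral.of_pow (Nat.pos_of_ne_zero hN) ?_
    rw [hq]
    exact isIntegral_algebraMap (R := ℚ) (A := ℝ) (x := q)
  let b : ι → K := fun i => ⟨a i, IntermediateField.subset_adjoin ℚ _ ⟨i, rfl⟩⟩
  have htrace : ∀ i, i ≠ j → Algebra.trace ℚ K (b i / b j) = 0 := by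
    intro i hij
    obtain ⟨q, hq⟩ := hpow i
    obtain ⟨q', hq'⟩ := hpow j
    have hmin : minpoly ℚ (a i / a j) = minpoly ℚ (b i / b j) :=
      minpoly.algHom_eq K.val.toRingHom.toRatAlgHom K.val.injective (b i / b j)
    rw [trace_eq_finrank_mul_minpoly_nextCoeff, ← hmin, minpoly_nextCoeff_eq_zero_of_pow_eq_ratCast (div_pos (ha i) (ha j)) hN
      (q := q / q') (by rw [div_pow, hq, hq', Rat.cast_div]) (hirr i j hij)]
    simp
  have hbj : b j ≠ 0 := fun h => (ha j).ne' (congrArg Subtype.val h)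
  have hsum : ∑ i, c i • (b i / b j) = 0 := by
    have : ∑ i, c i • b i = 0 := by
      apply K.val.injective
      simpa [b, map_sum] using hc
    simp_rw [div_eq_mul_inv, ← smul_mul_assoc]
    rw [← Finset.sum_mul, this, zero_mul]
  have h := congrArg (Algebra.trace ℚ K) hsum
  rw [map_sum, Finset.sum_eq_single j (fun i _ hij => by rw [map_smul, htrace i hij, smul_zero])
    (by simp), map_smul, div_self hbj, map_zero, ← map_one (algebraMap ℚ K),
    Algebra.trace_algebraMap] at h
  simpa [Module.finrank_pos.ne'] using h

theorem padicValRat_prod_mul_prime_pow {ι : Type*} [Fintype ι] {p r : ι → ℕ}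
    (hp : ∀ i, (p i).Prime) (hpdist : Function.Injective p) (hnd : ∀ i j, ¬ p i ∣ r j)
    (f : ι → ℕ) (j : ι) :
    padicValRat (p j) ((∏ i, (r i * p i) ^ f i : ℕ) : ℚ) = f j := by
  classical
  have hr : ∀ i, r i ≠ 0 := fun i h => hnd i i (h ▸ dvd_zero _)
  have hval : ∀ i, (r i * p i).factorization (p j) = if i = j then 1 else 0 := by
    intro i
    rw [Nat.factorization_mul (hr i) (hp i).ne_zero, Finsupp.add_apply,
      Nat.factorization_eq_zero_of_not_dvd (hnd j i), (hp i).factorization, zero_add,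
      Finsupp.single_apply]
    simp [hpdist.eq_iff]
  rw [padicValRat.of_nat, ← Nat.factorization_def _ (hp j), Nat.factorization_prod
    (fun i _ => pow_ne_zero _ (mul_ne_zero (hr i) (hp i).ne_zero)), Finsupp.finsetSum_apply]
  simp [Nat.factorization_pow, hval]

/-- Distinct reduced monomials in the roots have irrational ratio. -/
theorem irrational_prod_pow_div_prod_pow {ι : Type*} [Fintype ι] {p r n : ι → ℕ}
    (hp : ∀ i, (p i).Prime) (hpdist : Function.Injective p) (hnd : ∀ i j, ¬ p i ∣ r j)
    {x : ι → ℝ} (hxpos : ∀ i, 0 < x i) (hroot : ∀ i, x i ^ n i = ((r i * p i : ℕ) : ℝ))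
    {k l : Π i, Fin (n i)} (hkl : k ≠ l) :
    Irrational ((∏ i, x i ^ (k i : ℕ)) / ∏ i, x i ^ (l i : ℕ)) := by
  classical
  rintro ⟨q, hq⟩
  have hn : ∀ i, n i ≠ 0 := fun i => (Fin.pos (k i)).ne'
  have hr : ∀ i, r i ≠ 0 := fun i h => hnd i i (h ▸ dvd_zero _)
  have hpos : ∀ m : Π i, Fin (n i), 0 < ∏ i, x i ^ (m i : ℕ) :=
    fun m => Finset.prod_pos fun i _ => pow_pos (hxpos i) _
  rw [eq_div_iff (hpos l).ne'] at hq
  have hq0 : q ≠ 0 := by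
    rintro rfl
    exact (hpos k).ne (by simpa using hq)
  let M : ι → ℕ := fun i => ∏ j ∈ Finset.univ.erase i, n j
  have hM : ∀ i, n i * M i = ∏ j, n j := fun i => Finset.mul_prod_erase _ _ (Finset.mem_univ i)
  have hpow : ∀ m : Π i, Fin (n i), (∏ i, x i ^ (m i : ℕ)) ^ (∏ j, n j) =
      (((∏ i, (r i * p i) ^ (m i * M i) : ℕ) : ℚ) : ℝ) := by
    intro m
    rw [Rat.cast_natCast, Nat.cast_prod, ← Finset.prod_pow]
    refine Finset.prod_congr rfl fun i _ => ?_
    rw [Nat.cast_pow, ← hroot i, ← pow_mul, ← pow_mul, ← hM i]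
    ring
  have hrat : q ^ (∏ j, n j) * ((∏ i, (r i * p i) ^ (l i * M i) : ℕ) : ℚ) =
      ((∏ i, (r i * p i) ^ (k i * M i) : ℕ) : ℚ) := by
    have := congrArg (fun y : ℝ => y ^ (∏ j, n j)) hq
    beta_reduce at this
    rw [mul_pow, hpow, hpow, ← Rat.cast_pow, ← Rat.cast_mul] at this
    exact Rat.cast_injective this
  apply hkl
  funext j
  have : Fact (p j).Prime := ⟨hp j⟩
  have hv := congrArg (padicValRat (p j)) hrat
  rw [padicValRat.mul (pow_ne_zero _ hq0) (Nat.cast_ne_zero.2 (Finset.prod_ne_zero_iff.2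
      fun i _ => pow_ne_zero _ (mul_ne_zero (hr i) (hp i).ne_zero))), padicValRat.pow,
    padicValRat_prod_mul_prime_pow hp hpdist hnd, padicValRat_prod_mul_prime_pow hp hpdist hnd,
    ← hM j] at hv
  have hM0 : (M j : ℤ) ≠ 0 := Nat.cast_ne_zero.2 (Finset.prod_ne_zero_iff.2 fun i _ => hn i)
  have hv' : (n j : ℤ) * padicValRat (p j) q = (k j : ℕ) - (l j : ℕ) := by
    apply mul_right_cancel₀ hM0
    push_cast at hv
    linear_combination hv
  have hzero := Int.eq_zero_of_abs_lt_dvd ⟨_, hv'.symm⟩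
    (abs_lt.2 ⟨by have := (l j).2; omega, by have := (k j).2; omega⟩)
  exact Fin.ext (by omega)

/-- If the monomials with exponents `k i < n i` evaluate to linearly independent elements, then a
polynomial of degree less than `n i` in each variable is determined by its value. -/
theorem MvPolynomial.eq_zero_of_aeval_eq_zero_of_linearIndependent {ι R A : Type*} [Fintype ι]
    [CommRing R] [CommRing A] [Algebra R A] {n : ι → ℕ} {x : ι → A}
    (h : LinearIndependent R (fun k : (Π i, Fin (n i)) => ∏ i, x i ^ (k i : ℕ)))
    {P : MvPolynomial ι R} (hdeg : ∀ i, P.degreeOf i < n i) (hP : MvPolynomial.aeval x P = 0) :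
    P = 0 := by
  classical
  let e : (Π i, Fin (n i)) → (ι →₀ ℕ) := fun k => Finsupp.equivFunOnFinite.symm fun i => (k i : ℕ)
  have he : Function.Injective e := fun k l hkl =>
    _root_.funext fun i => Fin.ext (DFunLike.congr_fun hkl i)
  have hsurj : ∀ m ∈ P.support, ∃ k, e k = m := fun m hm =>
    ⟨fun i => ⟨m i, (MvPolynomial.monomial_le_degreeOf i hm).trans_lt (hdeg i)⟩, by ext; rfl⟩
  have hc := Fintype.linearIndependent_iff.1 h (fun k => P.coeff (e k)) <| by
    rw [← hP, MvPolynomial.aeval_def, MvPolynomial.eval₂_eq']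
    symm
    rw [Finset.sum_subset (s₂ := Finset.univ.image e), Finset.sum_image he.injOn]
    · simp [Algebra.smul_def, e]
    · intro m hm
      simpa using hsurj m hm
    · intro m _ hm
      simp [MvPolynomial.notMem_support_iff.1 hm]
  by_contra hne
  obtain ⟨m, hm⟩ := MvPolynomial.support_nonempty.2 hne
  obtain ⟨k, rfl⟩ := hsurj m hm
  exact MvPolynomial.mem_support_iff.1 hm (hc k)

/-- Besicovitch's theorem: let `p 1, …, p s` be distinct primes, `r i` positive
integers not divisible by any of the `p j`, and `y i = r i * p i`. Let `x i` be
the positive real `n i`-th root of `y i`. Then every polynomial over `ℚ` whose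
degree in the `i`-th variable is at most `n i - 1` and which vanishes at
`(x 1, …, x s)` is the zero polynomial; equivalently, the monomials
`∏ i, x i ^ k i`, `0 ≤ k i ≤ n i - 1`, are linearly independent over `ℚ`. -/
theorem besicovitch_roots_of_integers
    (s : ℕ) (p r n : Fin s → ℕ)
    (hp : ∀ i, (p i).Prime) (hpdist : Function.Injective p)
    (hr : ∀ i, 0 < r i) (hnd : ∀ i j, ¬ p i ∣ r j)
    (hn : ∀ i, 0 < n i)
    (x : Fin s → ℝ) (hxpos : ∀ i, 0 < x i)
    (hroot : ∀ i, x i ^ n i = ((r i * p i : ℕ) : ℝ)) :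
    (∀ P : MvPolynomial (Fin s) ℚ,
        (∀ i, P.degreeOf i ≤ n i - 1) →
        MvPolynomial.aeval x P = 0 → P = 0)
    ∧ LinearIndependent ℚ
        (fun k : (Π i, Fin (n i)) => ∏ i, x i ^ (k i : ℕ)) := by
  have hli : LinearIndependent ℚ (fun k : (Π i, Fin (n i)) => ∏ i, x i ^ (k i : ℕ)) := by
    refine linearIndependent_of_pow_eq_ratCast_of_irrational_div
      (fun k => Finset.prod_pos fun i _ => pow_pos (hxpos i) _)
      (N := ∏ i, n i) (Finset.prod_ne_zero_iff.2 fun i _ => (hn i).ne') (fun k => ?_)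
      (fun k l hkl => irrational_prod_pow_div_prod_pow hp hpdist hnd hxpos hroot hkl)
    have hx : ∀ i, ∃ q : ℚ, (x i ^ (k i : ℕ)) ^ (∏ j, n j) = (q : ℝ) := fun i => by
      obtain ⟨m, hm⟩ := Finset.dvd_prod_of_mem n (Finset.mem_univ i)
      refine ⟨((r i * p i : ℕ) : ℚ) ^ (m * k i), ?_⟩
      rw [Rat.cast_pow, Rat.cast_natCast, ← hroot i, hm]
      ring
    choose q hq using hx
    exact ⟨∏ i, q i, by rw [← Finset.prod_pow, Rat.cast_prod, Finset.prod_congr rfl fun i _ => hq i]⟩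
  refine ⟨fun P hdeg hP => ?_, hli⟩
  exact MvPolynomial.eq_zero_of_aeval_eq_zero_of_linearIndependent hli
    (fun i => (hdeg i).trans_lt (Nat.sub_lt (hn i) one_pos)) hP
end

section
/- (Lindemann–Weierstrass, as used.) Let α₁, …, α_s be real algebraic numbers that are linearly independent over ℚ. Then the real numbers e^{α₁}, …, e^{α_s} are transcendental and linearly independent over the field of real algebraic numbers; that is, if a₁, …, a_s are real algebraic numbers with a₁ e^{α₁} + ⋯ + a_s e^{α_s} = 0, then a₁ = ⋯ = a_s = 0. -/
open Polynomial
open scoped Nat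

theorem isIntegral_leadingCoeff_pow_mul_aeval {R A : Type*} [CommRing R] [CommRing A] [Algebra R A]
    {f g : R[X]} {x : A} (hx : aeval x f = 0) {k : ℕ} (hk : g.natDegree ≤ k) :
    IsIntegral R (algebraMap R A f.leadingCoeff ^ k * aeval x g) := by
  have hint := isIntegral_leadingCoeff_smul f x hx
  rw [aeval_eq_sum_range' (Nat.lt_succ_of_le hk), Finset.mul_sum]
  refine IsIntegral.sum _ fun i hi ↦ ?_
  have hik : i ≤ k := Nat.lt_succ_iff.mp (Finset.mem_range.mp hi)
  have : algebraMap R A f.leadingCoeff ^ k * g.coeff i • x ^ i =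
      algebraMap R A (f.leadingCoeff ^ (k - i) * g.coeff i) * (f.leadingCoeff • x) ^ i := by
    rw [← Nat.sub_add_cancel hik, pow_add, Algebra.smul_def, Algebra.smul_def, map_mul, map_pow,
      Nat.add_sub_cancel]
    ring
  rw [this]
  exact isIntegral_algebraMap.mul (hint.pow i)

theorem exists_int_polynomial_aeval_eq_zero {K : Type*} [Field K] [NumberField K] (S : Finset K)
    (h0 : (0 : K) ∉ S) : ∃ f : ℤ[X], f.eval 0 ≠ 0 ∧ ∀ x ∈ S, aeval x f = 0 := by
  have h : ∀ x : S, ∃ q : ℤ[X], q.coeff 0 ≠ 0 ∧ aeval (x : K) q = 0 := fun x ↦ by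
    have halg : IsAlgebraic ℤ (x : K) :=
      (IsFractionRing.isAlgebraic_iff ℤ ℚ K).mpr (Algebra.IsAlgebraic.isAlgebraic (x : K))
    refine halg.exists_nonzero_coeff_and_aeval_eq_zero (mem_nonZeroDivisors_of_ne_zero ?_)
    exact fun hx ↦ h0 (hx ▸ x.2)
  choose q hq0 hq using h
  refine ⟨∏ x, q x, ?_, fun x hx ↦ ?_⟩
  · rw [eval_prod]
    exact Finset.prod_ne_zero_iff.mpr fun x _ ↦ by simpa [coeff_zero_eq_eval_zero] using hq0 x
  · rw [map_prod]
    exact Finset.prod_eq_zero (Finset.mem_univ ⟨x, hx⟩) (hq ⟨x, hx⟩)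

theorem exists_int_eq_of_isIntegral_of_fixed {K : Type*} [Field K] [NumberField K] [IsGalois ℚ K]
    {y : K} (hint : IsIntegral ℤ y) (hfix : ∀ σ : Gal(K/ℚ), σ y = y) : ∃ m : ℤ, (m : K) = y := by
  obtain ⟨r, rfl⟩ := (IsGalois.mem_range_algebraMap_iff_fixed y).mpr hfix
  rw [isIntegral_algebraMap_iff (algebraMap ℚ K).injective] at hint
  obtain ⟨m, rfl⟩ := IsIntegrallyClosed.isIntegral_iff.mp hint
  exact ⟨m, by simp⟩

theorem int_add_sum_int_mul_exp_ne_zero {K : Type*} [Field K] [NumberField K] [IsGalois ℚ K]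
    [Algebra K ℂ] (S : Finset K) (h0 : (0 : K) ∉ S) (b : K → ℤ)
    (hS : ∀ σ : Gal(K/ℚ), ∀ x ∈ S, σ x ∈ S) (hb : ∀ σ : Gal(K/ℚ), ∀ x, b (σ x) = b x)
    {b₀ : ℤ} (hb₀ : b₀ ≠ 0) :
    (b₀ : ℂ) + ∑ x ∈ S, (b x : ℂ) * Complex.exp (algebraMap K ℂ x) ≠ 0 := by
  intro hsum
  obtain ⟨f, hf0, hf⟩ := exists_int_polynomial_aeval_eq_zero S h0
  have hfne : f ≠ 0 := by rintro rfl; simp at hf0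
  obtain ⟨c, hc⟩ := LindemannWeierstrass.exp_polynomial_approx f hf0
  set d := f.leadingCoeff with hd
  have hd0 : d ≠ 0 := leadingCoeff_ne_zero.mpr hfne
  set B : ℝ := ∑ x ∈ S, |(b x : ℝ)|
  set D : ℝ := |(d : ℝ)| ^ f.natDegree
  have hlim := FloorSemiring.tendsto_mul_pow_div_factorial_sub_atTop B (D * c) 1
  obtain ⟨N, hN⟩ := Filter.eventually_atTop.mp (hlim.eventually (gt_mem_nhds one_pos))
  obtain ⟨p, hpN, hp⟩ := Nat.exists_infinite_primes
    (N + (f.eval 0).natAbs + d.natAbs + b₀.natAbs + 1)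
  obtain ⟨n, hn, g, hgdeg, hg⟩ := hc p (by omega) hp
  set k := p * f.natDegree
  obtain ⟨m, hm⟩ : ∃ m : ℤ, (m : K) = ∑ x ∈ S, (b x : K) * ((d : K) ^ k * aeval x g) := by
    refine exists_int_eq_of_isIntegral_of_fixed ?_ fun σ ↦ ?_
    · refine IsIntegral.sum _ fun x hx ↦ (isIntegral_algebraMap (A := K) (x := b x)).mul ?_
      exact isIntegral_leadingCoeff_pow_mul_aeval (hf x hx) (hgdeg.trans (Nat.sub_le _ _))
    · rw [map_sum]
      refine Finset.sum_bij (fun x _ ↦ σ x) (hS σ) (fun _ _ _ _ h ↦ σ.injective h)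
        (fun x hx ↦ ⟨σ⁻¹ x, hS _ x hx, ?_⟩) fun x _ ↦ ?_
      · exact σ.apply_symm_apply x
      · have : σ (aeval x g) = aeval (σ x) g :=
          (aeval_algHom_apply (σ.toAlgHom.restrictScalars ℤ) x g).symm
        simp [hb, this]
  have hmC : (m : ℂ) = ∑ x ∈ S, (b x : ℂ) * ((d : ℂ) ^ k * aeval (algebraMap K ℂ x) g) := by
    have := congrArg (algebraMap K ℂ) hm
    simpa [aeval_algebraMap_apply] using this
  have key : ((d ^ k * (n * b₀) + p * m : ℤ) : ℂ) = -((d : ℂ) ^ k * ∑ x ∈ S, (b x : ℂ) *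
      (n * Complex.exp (algebraMap K ℂ x) - p * aeval (algebraMap K ℂ x) g)) := by
    have h1 : ∑ x ∈ S, (b x : ℂ) *
      (n * Complex.exp (algebraMap K ℂ x) - p * aeval (algebraMap K ℂ x) g) =
      n * ∑ x ∈ S, (b x : ℂ) * Complex.exp (algebraMap K ℂ x) -
        p * ∑ x ∈ S, (b x : ℂ) * aeval (algebraMap K ℂ x) g := by
      rw [Finset.mul_sum, Finset.mul_sum, ← Finset.sum_sub_distrib]
      exact Finset.sum_congr rfl fun _ _ ↦ by ring
    have h2 : (m : ℂ) = (d : ℂ) ^ k * ∑ x ∈ S, (b x : ℂ) * aeval (algebraMap K ℂ x) g := by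
      rw [hmC, Finset.mul_sum]
      exact Finset.sum_congr rfl fun _ _ ↦ by ring
    rw [h1]
    push_cast
    linear_combination (d : ℂ) ^ k * n * hsum + p * h2
  have hne : d ^ k * (n * b₀) + p * m ≠ 0 := by
    intro h
    have hpp : Prime (p : ℤ) := Nat.prime_iff_prime_int.mp hp
    have hdvd : (p : ℤ) ∣ d ^ k * (n * b₀) :=
      (dvd_add_left (dvd_mul_right _ _)).mp (h ▸ dvd_zero _)
    have small : ∀ z : ℤ, z ≠ 0 → z.natAbs < p → ¬ (p : ℤ) ∣ z := fun z hz hlt hdz ↦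
      absurd (Nat.le_of_dvd (Int.natAbs_pos.mpr hz) (Int.natCast_dvd.mp hdz)) (by omega)
    rcases hpp.dvd_or_dvd hdvd with h | h
    · exact small d hd0 (by omega) (hpp.dvd_of_dvd_pow h)
    · rcases hpp.dvd_or_dvd h with h | h
      · exact hn h
      · exact small b₀ hb₀ (by omega) h
  have hge : (1 : ℝ) ≤ ‖((d ^ k * (n * b₀) + p * m : ℤ) : ℂ)‖ := by
    rw [Complex.norm_intCast]
    exact_mod_cast Int.one_le_abs hne
  have hle : ‖((d ^ k * (n * b₀) + p * m : ℤ) : ℂ)‖ ≤ B * (D * c) ^ p / (p - 1)! := by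
    rw [key, norm_neg, norm_mul, norm_pow, Complex.norm_intCast]
    calc |(d : ℝ)| ^ k * _ ≤ |(d : ℝ)| ^ k * ∑ x ∈ S, |(b x : ℝ)| * (c ^ p / (p - 1)!) := by
          gcongr
          refine (norm_sum_le _ _).trans (Finset.sum_le_sum fun x hx ↦ ?_)
          rw [norm_mul, Complex.norm_intCast]
          gcongr
          have := hg (r := algebraMap K ℂ x) (by
            rw [mem_aroots]
            exact ⟨hfne, by rw [aeval_algebraMap_apply, hf x hx, map_zero]⟩)
          simpa only [zsmul_eq_mul, nsmul_eq_mul] using this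
      _ = _ := by
          rw [← Finset.sum_mul, mul_pow, ← pow_mul, mul_comm f.natDegree p]
          ring
  exact absurd (hge.trans hle) (not_le.mpr (hN p (by omega)))

/-- The evaluation `∑ aₓ [x] ↦ ∑ aₓ eˣ` of formal exponential sums with coefficients and exponents
in a subfield `K` of `ℂ`. -/
noncomputable def expEval (K : Type*) [Field K] [Algebra K ℂ] : AddMonoidAlgebra K K →ₐ[K] ℂ :=
  AddMonoidAlgebra.lift K ℂ K
    (Complex.expMonoidHom.comp (algebraMap K ℂ).toAddMonoidHom.toMultiplicative)

theorem expEval_apply {K : Type*} [Field K] [Algebra K ℂ] (f : AddMonoidAlgebra K K) :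
    expEval K f = f.coeff.sum fun x a ↦ algebraMap K ℂ a * Complex.exp (algebraMap K ℂ x) := by
  simp [expEval, AddMonoidAlgebra.lift_apply, Algebra.smul_def]

/-- The Galois action on the coefficients of a formal exponential sum. -/
noncomputable def galCoeff {K : Type*} [Field K] [Algebra ℚ K] (σ : Gal(K/ℚ)) :
    AddMonoidAlgebra K K →+* AddMonoidAlgebra K K :=
  AddMonoidAlgebra.mapRingHom K (σ : K →+* K)

/-- The Galois action on the exponents of a formal exponential sum. -/
noncomputable def galExponent {K : Type*} [Field K] [Algebra ℚ K] (σ : Gal(K/ℚ)) :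
    AddMonoidAlgebra K K →+* AddMonoidAlgebra K K :=
  AddMonoidAlgebra.mapDomainRingHom K (σ : K →+ K)

section

variable {K : Type*} [Field K] [Algebra ℚ K] (σ τ : Gal(K/ℚ)) (f : AddMonoidAlgebra K K) (x : K)

theorem coeff_galCoeff : (galCoeff σ f).coeff x = σ (f.coeff x) := by
  simp [galCoeff]

theorem coeff_galExponent : (galExponent σ f).coeff (σ x) = f.coeff x :=
  Finsupp.mapDomain_apply σ.injective _ _

theorem coeff_galExponent' : (galExponent σ f).coeff x = f.coeff (σ⁻¹ x) := by
  conv_lhs => rw [← σ.apply_symm_apply x]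
  exact coeff_galExponent _ _ _

theorem galCoeff_galCoeff : galCoeff σ (galCoeff τ f) = galCoeff (σ * τ) f := by
  ext x; simp [coeff_galCoeff]

theorem galExponent_galExponent : galExponent σ (galExponent τ f) = galExponent (σ * τ) f := by
  ext x; simp [coeff_galExponent']

theorem galCoeff_galExponent : galCoeff σ (galExponent τ f) = galExponent τ (galCoeff σ f) := by
  ext x; simp [coeff_galExponent', coeff_galCoeff]

theorem galCoeff_injective : Function.Injective (galCoeff σ) := fun f g h ↦ by
  ext x
  simpa [coeff_galCoeff] using congrArg (fun f ↦ f.coeff x) h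

theorem galExponent_injective : Function.Injective (galExponent σ) := fun f g h ↦ by
  ext x
  simpa [coeff_galExponent] using congrArg (fun f ↦ f.coeff (σ x)) h

end

theorem exists_invariant_expEval_eq_zero {K : Type*} [Field K] [NumberField K] [Algebra K ℂ]
    {f : AddMonoidAlgebra K K} (hf : f ≠ 0) (h : expEval K f = 0) :
    ∃ F : AddMonoidAlgebra K K, F ≠ 0 ∧ expEval K F = 0 ∧
      (∀ σ : Gal(K/ℚ), galCoeff σ F = F) ∧ ∀ σ : Gal(K/ℚ), galExponent σ F = F := by
  refine ⟨∏ σ : Gal(K/ℚ), ∏ τ : Gal(K/ℚ), galExponent σ (galCoeff τ f), ?_, ?_, fun ρ ↦ ?_,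
    fun ρ ↦ ?_⟩
  · simp only [Finset.prod_ne_zero_iff]
    intro σ _ τ _
    rwa [Ne, map_eq_zero_iff _ (galExponent_injective σ), map_eq_zero_iff _ (galCoeff_injective τ)]
  · simp only [map_prod]
    refine Finset.prod_eq_zero (Finset.mem_univ 1) (Finset.prod_eq_zero (Finset.mem_univ 1) ?_)
    have : galExponent (1 : Gal(K/ℚ)) (galCoeff 1 f) = f := by
      ext x; simp [coeff_galExponent', coeff_galCoeff]
    rw [this, h]
  · simp only [map_prod, galCoeff_galExponent, galCoeff_galCoeff]
    exact Finset.prod_congr rfl fun σ _ ↦ Fintype.prod_equiv (Equiv.mulLeft ρ) _ _ fun _ ↦ rfl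
  · simp only [map_prod, galExponent_galExponent]
    exact Fintype.prod_equiv (Equiv.mulLeft ρ) _ _ fun _ ↦ rfl

theorem exists_invariant_coeff_zero_ne_zero {K : Type*} [Field K] [NumberField K] [Algebra K ℂ]
    {f : AddMonoidAlgebra K K} (hf : f ≠ 0) (h : expEval K f = 0) :
    ∃ F : AddMonoidAlgebra K K, F.coeff 0 ≠ 0 ∧ expEval K F = 0 ∧
      (∀ σ : Gal(K/ℚ), galCoeff σ F = F) ∧ ∀ σ : Gal(K/ℚ), galExponent σ F = F := by
  obtain ⟨F, hF0, hF, hcoeff, hexp⟩ := exists_invariant_expEval_eq_zero hf h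
  obtain ⟨x, hx⟩ : ∃ x, F.coeff x ≠ 0 := by
    by_contra! hall
    exact hF0 (by ext x; simpa using hall x)
  refine ⟨F * ∑ σ : Gal(K/ℚ), AddMonoidAlgebra.single (-σ x) 1, ?_, ?_, fun ρ ↦ ?_, fun ρ ↦ ?_⟩
  · have hinv (σ : Gal(K/ℚ)) : F.coeff (σ x) = F.coeff x := by
      conv_lhs => rw [← hexp σ]
      exact coeff_galExponent σ F x
    simp [Finset.mul_sum, AddMonoidAlgebra.coeff_sum, hinv, hx]
  · rw [map_mul, hF, zero_mul]
  · rw [map_mul, hcoeff, map_sum]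
    simp [galCoeff]
  · rw [map_mul, hexp, map_sum]
    congr 1
    refine Fintype.sum_equiv (Equiv.mulLeft ρ) _ _ fun σ ↦ ?_
    simp [galExponent]

theorem expEval_injective (K : Type*) [Field K] [NumberField K] [IsGalois ℚ K] [Algebra K ℂ] :
    Function.Injective (expEval K) := by
  rw [injective_iff_map_eq_zero]
  classical
  intro f h
  by_contra hf
  obtain ⟨F, hF0, hF, hcoeff, hexp⟩ := exists_invariant_coeff_zero_ne_zero hf h
  have hrat (x : K) : ∃ r : ℚ, algebraMap ℚ K r = F.coeff x :=
    (IsGalois.mem_range_algebraMap_iff_fixed _).mpr fun σ ↦ by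
      rw [← coeff_galCoeff, hcoeff]
  choose r hr using hrat
  have hrσ (σ : Gal(K/ℚ)) (x : K) : r (σ x) = r x := by
    apply (algebraMap ℚ K).injective
    rw [hr, hr, ← coeff_galExponent σ F x, hexp]
  obtain ⟨⟨q, hq⟩, hqr⟩ := IsLocalization.exist_integer_multiples (nonZeroDivisors ℤ)
    F.coeff.support r
  have hq0 : q ≠ 0 := nonZeroDivisors.ne_zero hq
  have hint (x : K) : ∃ b : ℤ, (b : ℚ) = q * r x := by
    by_cases hx : x ∈ F.coeff.support
    · obtain ⟨b, hb⟩ := hqr x hx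
      exact ⟨b, by simpa using hb⟩
    · refine ⟨0, ?_⟩
      have : r x = 0 := (algebraMap ℚ K).injective (by
        rw [hr, map_zero]; exact Finsupp.notMem_support_iff.mp hx)
      simp [this]
  choose b hb using hint
  have hbC (x : K) : (b x : ℂ) = q * algebraMap K ℂ (F.coeff x) := by
    rw [← hr, ← IsScalarTower.algebraMap_apply ℚ K ℂ, ← Rat.cast_intCast, hb]
    simp
  have hb0 : b 0 ≠ 0 := fun h0 ↦ by
    have := hbC 0
    simp [h0, hq0, hF0] at this
  refine int_add_sum_int_mul_exp_ne_zero (F.coeff.support.erase 0) (by simp) b (fun σ x hx ↦ ?_)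
    (fun σ x ↦ ?_) hb0 ?_
  · rw [Finset.mem_erase, Finsupp.mem_support_iff, ← hr] at hx ⊢
    rw [hrσ]
    exact ⟨by simpa using hx.1, hx.2⟩
  · have : (b (σ x) : ℚ) = b x := by rw [hb, hb, hrσ]
    exact_mod_cast this
  · have h1 : (b 0 : ℂ) = b 0 * Complex.exp (algebraMap K ℂ 0) := by simp
    rw [h1, Finset.add_sum_erase _ (fun x ↦ (b x : ℂ) * Complex.exp (algebraMap K ℂ x))
      (Finsupp.mem_support_iff.mpr hF0)]
    rw [expEval_apply, Finsupp.sum] at hF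
    simp only [hbC, mul_assoc]
    rw [← Finset.mul_sum, hF, mul_zero]

theorem eq_zero_of_sum_mul_exp_eq_zero {ι : Type*} [Fintype ι] {α a : ι → ℂ}
    (hα : ∀ i, IsAlgebraic ℚ (α i)) (hinj : Function.Injective α) (ha : ∀ i, IsAlgebraic ℚ (a i))
    (hsum : ∑ i, a i * Complex.exp (α i) = 0) (i : ι) : a i = 0 := by
  let E := IntermediateField.adjoin ℚ (Set.range α ∪ Set.range a)
  have : FiniteDimensional ℚ E := by
    refine IntermediateField.finiteDimensional_adjoin fun x hx ↦ ?_
    rcases hx with ⟨i, rfl⟩ | ⟨i, rfl⟩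
    · exact (hα i).isIntegral
    · exact (ha i).isIntegral
  let K := IntermediateField.normalClosure ℚ E ℂ
  have : NumberField K := ⟨⟩
  have : IsNormalClosure ℚ E K :=
    Algebra.IsAlgebraic.isNormalClosure_normalClosure fun _ ↦ IsAlgClosed.splits _
  have : Normal ℚ K := IsNormalClosure.normal (K := E)
  have : IsGalois ℚ K := ⟨⟩
  have hE : E ≤ K := IntermediateField.le_normalClosure E
  let α' (i : ι) : K := ⟨α i, hE (IntermediateField.subset_adjoin _ _ (.inl ⟨i, rfl⟩))⟩
  let a' (i : ι) : K := ⟨a i, hE (IntermediateField.subset_adjoin _ _ (.inr ⟨i, rfl⟩))⟩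
  have hα' : Function.Injective α' := fun i j h ↦ hinj (congrArg Subtype.val h)
  have h0 : ∑ i, AddMonoidAlgebra.single (α' i) (a' i) = 0 := by
    apply expEval_injective K
    rw [map_sum, map_zero, ← hsum]
    exact Finset.sum_congr rfl fun i _ ↦ by simp [expEval_apply, α', a']
  have := congrArg (fun f ↦ f.coeff (α' i)) h0
  classical
  simp [AddMonoidAlgebra.coeff_sum, Finsupp.single_apply, hα'.eq_iff] at this
  exact congrArg Subtype.val this

theorem Real.eq_zero_of_sum_mul_exp_eq_zero {ι : Type*} [Fintype ι] {α a : ι → ℝ}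
    (hα : ∀ i, IsAlgebraic ℚ (α i)) (hinj : Function.Injective α) (ha : ∀ i, IsAlgebraic ℚ (a i))
    (hsum : ∑ i, a i * Real.exp (α i) = 0) (i : ι) : a i = 0 := by
  have := _root_.eq_zero_of_sum_mul_exp_eq_zero (α := fun i ↦ (α i : ℂ)) (a := fun i ↦ (a i : ℂ))
    (fun i ↦ (hα i).algebraMap) (Complex.ofReal_injective.comp hinj) (fun i ↦ (ha i).algebraMap)
    (by exact_mod_cast congrArg Complex.ofReal hsum) i
  exact_mod_cast this

theorem Real.transcendental_exp {x : ℝ} (hx : IsAlgebraic ℚ x) (hx0 : x ≠ 0) :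
    Transcendental ℚ (Real.exp x) := by
  intro hexp
  have h := Real.eq_zero_of_sum_mul_exp_eq_zero (α := ![x, 0]) (a := ![1, -Real.exp x])
    (Fin.forall_fin_two.mpr ⟨hx, isAlgebraic_zero⟩)
    (fun i j hij ↦ by fin_cases i <;> fin_cases j <;> simp_all [eq_comm])
    (Fin.forall_fin_two.mpr ⟨isAlgebraic_one, hexp.neg⟩) (by simp) 0
  simp at h

/-- Lindemann–Weierstrass (as used): if `α 1, …, α s` are real algebraic
numbers that are linearly independent over `ℚ`, then `e ^ α 1, …, e ^ α s` are
transcendental and linearly independent over the real algebraic numbers: any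
vanishing linear combination with real algebraic coefficients is trivial. -/
theorem lindemann_weierstrass_exp
    (s : ℕ) (α : Fin s → ℝ)
    (halg : ∀ i, IsAlgebraic ℚ (α i))
    (hli : LinearIndependent ℚ α) :
    (∀ i, Transcendental ℚ (Real.exp (α i))) ∧
      ∀ a : Fin s → ℝ, (∀ i, IsAlgebraic ℚ (a i)) →
        (∑ i, a i * Real.exp (α i)) = 0 → ∀ i, a i = 0 := by
  refine ⟨fun i ↦ Real.transcendental_exp (halg i) (hli.ne_zero i), fun a ha hsum ↦ ?_⟩
  exact Real.eq_zero_of_sum_mul_exp_eq_zero halg hli.injective ha hsum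
end

section
/- Let p₁, …, p_m be distinct prime numbers and q₁, …, q_m integers with q_i ≥ 2. If d_k and d'_k (for multi-indices k = (k₁, …, k_m) with 0 ≤ k_i ≤ q_i − 1) are rational numbers with ∑_k d_k ∏_{i=1}^{m} (p_i^{1/q_i})^{k_i} = ∑_k d'_k ∏_{i=1}^{m} (p_i^{1/q_i})^{k_i}, then d_k = d'_k for every multi-index k. In particular, such a sum is rational if and only if d_k = 0 for every k ≠ (0, …, 0), and it equals zero if and only if all d_k vanish. -/
open Polynomial

/-- The minimal polynomial over `ℚ` of a positive real radical is a binomial. -/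
theorem minpoly_eq_X_pow_sub_C_of_pow_eq_ratCast {a : ℝ} (ha : 0 < a) {N : ℕ} (hN : N ≠ 0)
    {c : ℚ} (hc : a ^ N = c) :
    ∃ b : ℚ, minpoly ℚ a = X ^ (minpoly ℚ a).natDegree - C b := by
  have hroot : aeval a (X ^ N - C c : ℚ[X]) = 0 := by simp [hc]
  have hint : IsIntegral ℚ a := ⟨X ^ N - C c, monic_X_pow_sub_C c hN, hroot⟩
  have hmonic := minpoly.monic hint
  have hdvd := minpoly.dvd ℚ a hroot
  have hd := (minpoly.natDegree_pos hint).ne'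
  set P := minpoly ℚ a with hP
  have hnorm : ∀ z ∈ (P.map (algebraMap ℚ ℂ)).roots, ‖z‖ = a := by
    intro z hz
    have hz0 : aeval z P = 0 := by
      rw [aeval_def, ← eval_map]
      exact (mem_roots'.1 hz).2
    have hzN : aeval z (X ^ N - C c : ℚ[X]) = 0 := aeval_eq_zero_of_dvd_aeval_eq_zero hdvd hz0
    have hzc : z ^ N = ((a ^ N : ℝ) : ℂ) := by
      rw [hc]
      simpa [sub_eq_zero] using hzN
    have hnormN : ‖z‖ ^ N = a ^ N := by
      rw [← norm_pow, hzc, Complex.norm_real, Real.norm_of_nonneg (by positivity)]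
    exact (pow_left_inj₀ (norm_nonneg z) ha.le hN).1 hnormN
  have hsplits : (P.map (algebraMap ℚ ℂ)).Splits := IsAlgClosed.splits _
  have hcoeff : ((|P.coeff 0| : ℚ) : ℝ) = a ^ P.natDegree := by
    have h := hsplits.coeff_zero_eq_prod_roots_of_monic (hmonic.map _)
    have hprod : ‖(P.map (algebraMap ℚ ℂ)).roots.prod‖ = a ^ P.natDegree := by
      have hcard := hsplits.natDegree_eq_card_roots
      rw [natDegree_map] at hcard
      rw [← normHom_apply, map_multiset_prod,
        Multiset.map_congr rfl (fun z hz => by rw [normHom_apply, hnorm z hz]),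
        Multiset.map_const', Multiset.prod_replicate, hcard]
    have h' := congrArg norm h
    rw [norm_mul, norm_pow, norm_neg, norm_one, one_pow, one_mul, hprod, coeff_map] at h'
    simpa using h'
  refine ⟨|P.coeff 0|, ?_⟩
  have hbin : aeval a (X ^ P.natDegree - C |P.coeff 0| : ℚ[X]) = 0 := by
    simp only [map_sub, map_pow, aeval_X, aeval_C, eq_ratCast]
    rw [hcoeff, sub_self]
  refine (eq_of_monic_of_dvd_of_natDegree_le hmonic (monic_X_pow_sub_C _ hd)
    (minpoly.dvd ℚ a hbin) ?_).symm
  rw [natDegree_X_pow_sub_C]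

/-- An irrational positive real radical has trace zero over `ℚ`. -/
theorem trace_eq_zero_of_pow_eq_ratCast {K : IntermediateField ℚ ℝ} [FiniteDimensional ℚ K]
    {a : K} (ha : 0 < (a : ℝ)) {N : ℕ} (hN : N ≠ 0) {c : ℚ} (hc : (a : ℝ) ^ N = c)
    (hirr : Irrational (a : ℝ)) : Algebra.trace ℚ K a = 0 := by
  obtain ⟨b, hb⟩ := minpoly_eq_X_pow_sub_C_of_pow_eq_ratCast ha hN hc
  have hint : IsIntegral ℚ (a : ℝ) :=
    ⟨X ^ N - C c, monic_X_pow_sub_C c hN, by simp [hc]⟩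
  have hdeg : 2 ≤ (minpoly ℚ (a : ℝ)).natDegree := by
    rw [minpoly.two_le_natDegree_iff hint]
    simpa [Irrational] using hirr
  have hmin : minpoly ℚ a = minpoly ℚ (a : ℝ) :=
    (minpoly.algebraMap_eq (algebraMap K ℝ).injective a).symm
  have hnext : (minpoly ℚ (a : ℝ)).nextCoeff = 0 := by
    rw [nextCoeff_of_natDegree_pos (by omega), hb, natDegree_X_pow_sub_C, coeff_sub, coeff_X_pow,
      coeff_C, if_neg (by omega), if_neg (by omega), sub_zero]
  rw [trace_eq_finrank_mul_minpoly_nextCoeff, hmin, hnext, neg_zero, mul_zero]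

/-- Positive real radicals with pairwise irrational ratios are linearly independent over `ℚ`. -/
theorem linearIndependent_of_pow_eq_ratCast {ι : Type*} [Finite ι] {x : ι → ℝ}
    (hx : ∀ i, 0 < x i) {N : ℕ} (hN : N ≠ 0) (hpow : ∀ i, ∃ c : ℚ, x i ^ N = c)
    (hirr : Pairwise fun i j => Irrational (x i / x j)) : LinearIndependent ℚ x := by
  have := Fintype.ofFinite ι
  let K := IntermediateField.adjoin ℚ (Set.range x)
  have : FiniteDimensional ℚ K := by
    refine IntermediateField.finiteDimensional_adjoin ?_
    rintro _ ⟨i, rfl⟩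
    obtain ⟨c, hc⟩ := hpow i
    exact ⟨X ^ N - C c, monic_X_pow_sub_C c hN, by simp [hc]⟩
  let y : ι → K := fun i => ⟨x i, IntermediateField.subset_adjoin ℚ _ ⟨i, rfl⟩⟩
  rw [Fintype.linearIndependent_iff]
  intro g hg j
  have hy : ∑ i, g i • y i = 0 := by
    apply (algebraMap K ℝ).injective
    rw [map_sum, map_zero, ← hg]
    rfl
  have hratio : ∑ i, g i • (y i / y j) = 0 := by
    rw [← zero_div (y j), ← hy, Finset.sum_div]
    exact Finset.sum_congr rfl fun i _ => (smul_div_assoc (g i) (y i) (y j)).symm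
  have htrace : ∀ i, i ≠ j → Algebra.trace ℚ K (y i / y j) = 0 := by
    intro i hij
    obtain ⟨c, hc⟩ := hpow i
    obtain ⟨e, he⟩ := hpow j
    have hcoe : ((y i / y j : K) : ℝ) = x i / x j := rfl
    refine trace_eq_zero_of_pow_eq_ratCast (N := N) (c := c / e) ?_ hN ?_ ?_
    · rw [hcoe]
      exact div_pos (hx i) (hx j)
    · rw [hcoe, div_pow, hc, he, Rat.cast_div]
    · rw [hcoe]
      exact hirr hij
  have hyj : y j ≠ 0 := fun h => (hx j).ne' (congrArg (algebraMap K ℝ) h)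
  have h := congrArg (Algebra.trace ℚ K) hratio
  rw [map_sum, map_zero, Finset.sum_eq_single j
    (fun i _ hij => by rw [map_smul, htrace i hij, smul_zero]) (by simp), div_self hyj, map_smul,
    ← map_one (algebraMap ℚ K), Algebra.trace_algebraMap, nsmul_one, smul_eq_mul] at h
  exact (mul_eq_zero.1 h).resolve_right (Nat.cast_ne_zero.2 Module.finrank_pos.ne')

section PrimeRoots

variable {ι : Type*} [Fintype ι] {p q : ι → ℕ} {r : ι → ℝ}

theorem prod_root_pow_pow_prod (hroot : ∀ i, r i ^ q i = p i) (k : ι → ℕ) [DecidableEq ι] :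
    (∏ i, r i ^ k i) ^ (∏ i, q i) =
      ((∏ i, (p i : ℚ) ^ ((∏ j ∈ Finset.univ.erase i, q j) * k i) : ℚ) : ℝ) := by
  push_cast
  rw [← Finset.prod_pow]
  refine Finset.prod_congr rfl fun i _ => ?_
  rw [← hroot, ← Finset.mul_prod_erase _ q (Finset.mem_univ i), ← pow_mul, ← pow_mul]
  congr 1
  ring

theorem padicValRat_prod_prime_pow (hp : ∀ i, (p i).Prime) (hpdist : Function.Injective p)
    (e : ι → ℕ) (i : ι) : padicValRat (p i) (∏ j, (p j : ℚ) ^ e j) = e i := by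
  classical
  have : Fact (p i).Prime := ⟨hp i⟩
  have h0 : ∀ j, (p j : ℚ) ≠ 0 := fun j => Nat.cast_ne_zero.2 (hp j).ne_zero
  rw [← Finset.mul_prod_erase _ _ (Finset.mem_univ i),
    padicValRat.mul (pow_ne_zero _ (h0 i))
      (Finset.prod_ne_zero_iff.2 fun j _ => pow_ne_zero _ (h0 j)), padicValRat.pow,
    padicValRat.self (hp i).one_lt, mul_one, add_eq_left]
  have hcast : (∏ j ∈ Finset.univ.erase i, (p j : ℚ) ^ e j) =
      ((∏ j ∈ Finset.univ.erase i, p j ^ e j : ℕ) : ℚ) := by push_cast; rfl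
  rw [hcast, padicValRat.of_nat, Nat.cast_eq_zero]
  refine padicValNat.eq_zero_of_not_dvd fun h => ?_
  obtain ⟨j, hj, hdvd⟩ := ((hp i).prime.dvd_finsetProd_iff _).1 h
  exact Finset.ne_of_mem_erase hj
    (hpdist ((Nat.prime_dvd_prime_iff_eq (hp i) (hp j)).1 ((hp i).dvd_of_dvd_pow hdvd))).symm

theorem irrational_prod_root_pow_div (hp : ∀ i, (p i).Prime) (hpdist : Function.Injective p)
    (hr : ∀ i, 0 < r i) (hroot : ∀ i, r i ^ q i = p i) {k l : ∀ i, Fin (q i)} (hkl : k ≠ l) :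
    Irrational ((∏ i, r i ^ (k i : ℕ)) / ∏ i, r i ^ (l i : ℕ)) := by
  classical
  rintro ⟨c, hc⟩
  refine hkl (funext fun i => Fin.ext ?_)
  have : Fact (p i).Prime := ⟨hp i⟩
  have hq0 : ∀ j, q j ≠ 0 := fun j => (Nat.zero_le _).trans_lt (k j).isLt |>.ne'
  have hpos : ∀ e : ι → ℕ, 0 < ∏ j, r j ^ e j := fun e =>
    Finset.prod_pos fun j _ => pow_pos (hr j) _
  have hc0 : c ≠ 0 := by
    rintro rfl
    exact (div_pos (hpos fun j => k j) (hpos fun j => l j)).ne (by simpa using hc)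
  rw [eq_div_iff (hpos fun j => l j).ne'] at hc
  have hpow := congrArg (· ^ ∏ j, q j) hc
  simp only [mul_pow] at hpow
  rw [prod_root_pow_pow_prod hroot fun j => l j, prod_root_pow_pow_prod hroot fun j => k j] at hpow
  rw [← Rat.cast_pow, ← Rat.cast_mul, Rat.cast_inj] at hpow
  have hprod0 : ∀ e : ι → ℕ, ∏ j, (p j : ℚ) ^ e j ≠ 0 := fun e =>
    Finset.prod_ne_zero_iff.2 fun j _ => pow_ne_zero _ (Nat.cast_ne_zero.2 (hp j).ne_zero)
  have hval := congrArg (padicValRat (p i)) hpow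
  rw [padicValRat.mul (pow_ne_zero _ hc0) (hprod0 _), padicValRat.pow,
    padicValRat_prod_prime_pow hp hpdist, padicValRat_prod_prime_pow hp hpdist,
    ← Finset.mul_prod_erase _ q (Finset.mem_univ i)] at hval
  have hQ : ((∏ j ∈ Finset.univ.erase i, q j : ℕ) : ℤ) ≠ 0 :=
    Nat.cast_ne_zero.2 (Finset.prod_ne_zero_iff.2 fun j _ => hq0 j)
  have hmod : (q i : ℤ) * padicValRat (p i) c + (l i : ℕ) = (k i : ℕ) := by
    refine mul_left_cancel₀ hQ ?_
    rw [Nat.cast_mul, Nat.cast_mul, Nat.cast_mul] at hval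
    linear_combination hval
  have hmodEq : (k i : ℕ) ≡ (l i : ℕ) [MOD q i] := by
    rw [← Int.natCast_modEq_iff, ← hmod]
    exact Int.modEq_iff_dvd.2 ⟨-padicValRat (p i) c, by ring⟩
  exact hmodEq.eq_of_lt_of_lt (k i).isLt (l i).isLt

theorem linearIndependent_prod_prime_root_pow (hp : ∀ i, (p i).Prime)
    (hpdist : Function.Injective p) (hq : ∀ i, q i ≠ 0) (hr : ∀ i, 0 < r i)
    (hroot : ∀ i, r i ^ q i = p i) :
    LinearIndependent ℚ fun k : ∀ i, Fin (q i) => ∏ i, r i ^ (k i : ℕ) := by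
  classical
  exact linearIndependent_of_pow_eq_ratCast
    (fun k => Finset.prod_pos fun i _ => pow_pos (hr i) _)
    (Finset.prod_ne_zero_iff.2 fun i _ => hq i)
    (fun k => ⟨_, prod_root_pow_pow_prod hroot fun i => k i⟩)
    fun k l hkl => irrational_prod_root_pow_div hp hpdist hr hroot hkl

end PrimeRoots


/-- Rational linear combinations of the monomials `∏ i, (p i ^ (1 / q i)) ^ k i`
(with `p i` distinct primes, `q i ≥ 2`, `0 ≤ k i ≤ q i - 1`) have unique
coefficients; in particular such a combination is rational iff all coefficients
of nonconstant monomials vanish, and it is zero iff all coefficients vanish. -/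
theorem prime_root_monomial_coefficients_unique
    (m : ℕ) (p q : Fin m → ℕ)
    (hp : ∀ i, (p i).Prime) (hpdist : Function.Injective p)
    (hq : ∀ i, 2 ≤ q i)
    (r : Fin m → ℝ) (hrpos : ∀ i, 0 < r i)
    (hroot : ∀ i, r i ^ q i = ((p i : ℕ) : ℝ)) :
    (∀ d d' : (Π i, Fin (q i)) → ℚ,
        (∑ k : (Π i, Fin (q i)), (d k : ℝ) * ∏ i, r i ^ (k i : ℕ)) =
          (∑ k : (Π i, Fin (q i)), (d' k : ℝ) * ∏ i, r i ^ (k i : ℕ)) →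
        d = d')
    ∧ (∀ d : (Π i, Fin (q i)) → ℚ,
        ((∃ c : ℚ, (∑ k : (Π i, Fin (q i)), (d k : ℝ) * ∏ i, r i ^ (k i : ℕ))
            = (c : ℝ)) ↔
          ∀ k : (Π i, Fin (q i)), (∃ i, (k i : ℕ) ≠ 0) → d k = 0))
    ∧ (∀ d : (Π i, Fin (q i)) → ℚ,
        ((∑ k : (Π i, Fin (q i)), (d k : ℝ) * ∏ i, r i ^ (k i : ℕ)) = 0 ↔
          ∀ k, d k = 0)) := by
  have hq0 : ∀ i, q i ≠ 0 := fun i => (two_pos.trans_le (hq i)).ne'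
  have hzero : ∀ d : (Π i, Fin (q i)) → ℚ,
      (∑ k : (Π i, Fin (q i)), (d k : ℝ) * ∏ i, r i ^ (k i : ℕ)) = 0 → ∀ k, d k = 0 := by
    intro d hd
    refine Fintype.linearIndependent_iff.1
      (linearIndependent_prod_prime_root_pow hp hpdist hq0 hrpos hroot) d ?_
    simpa only [Rat.smul_def] using hd
  have huniq : ∀ d d' : (Π i, Fin (q i)) → ℚ,
      (∑ k : (Π i, Fin (q i)), (d k : ℝ) * ∏ i, r i ^ (k i : ℕ)) =
        (∑ k : (Π i, Fin (q i)), (d' k : ℝ) * ∏ i, r i ^ (k i : ℕ)) → d = d' := by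
    intro d d' h
    refine funext fun k => sub_eq_zero.1 (hzero (fun k => d k - d' k) ?_ k)
    simp only [Rat.cast_sub, sub_mul, Finset.sum_sub_distrib, h, sub_self]
  have hconst : ∀ d : (Π i, Fin (q i)) → ℚ,
      (∀ k : (Π i, Fin (q i)), (∃ i, (k i : ℕ) ≠ 0) → d k = 0) →
        (∑ k : (Π i, Fin (q i)), (d k : ℝ) * ∏ i, r i ^ (k i : ℕ)) =
          d fun i => ⟨0, Nat.pos_of_ne_zero (hq0 i)⟩ := by
    intro d hd
    rw [Fintype.sum_eq_single fun i => ⟨0, Nat.pos_of_ne_zero (hq0 i)⟩]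
    · simp
    · intro k hk
      obtain ⟨i, hi⟩ := Function.ne_iff.1 hk
      rw [hd k ⟨i, fun h => hi (Fin.ext h)⟩, Rat.cast_zero, zero_mul]
  refine ⟨huniq, fun d => ⟨?_, fun hd => ⟨_, hconst d hd⟩⟩, fun d => ⟨hzero d, fun hd => ?_⟩⟩
  · rintro ⟨c, hc⟩
    have hd' : ∀ k : (Π i, Fin (q i)), (∃ i, (k i : ℕ) ≠ 0) →
        (if ∀ i, (k i : ℕ) = 0 then c else 0) = 0 :=
      fun k ⟨i, hi⟩ => if_neg fun h => hi (h i)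
    have h := huniq d (fun k => if ∀ i, (k i : ℕ) = 0 then c else 0) (by
      rw [hc, hconst _ hd', if_pos fun _ => rfl])
    rw [h]
    exact hd'
  · simp [hd]
end
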